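/- arXiv:1101.1680 — 2 statements merged into one kernel-verified Lean document; each statement's English description precedes it below -/
import Mathlib

section
/- (Contamination bound; Lemma 3.) In the duplicate-write/k-scan model, suppose k ≥ 1, the values x₀, x₁, …, x_N are pairwise distinct, and the writer performs N ≤ m·k AWrite operations. Call an AReadk contaminated if it returns a unanimous value v with v ∉ {x₀, x₁, …, x_N}. Then among any family of AReadk operations performed sequentially by the reader (every low-level read of an earlier AReadk ends before every low-level read of a later AReadk begins), at most m are contaminated. -/
open scoped Classical

/-- A writer execution in the duplicate-write model: safe registers `R_a` and
`R_b` initially both hold `x 0`; the writer performs `N` AWrite operations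
with values `x 1, …, x N`, the `i`-th AWrite being a low-level write of `x i`
to `R_a` over the real interval `[sa i, ea i]` followed by a low-level write
of `x i` to `R_b` over `[sb i, eb i]`, with all write intervals sequential. -/
structure DWWriter (N : ℕ) where
  x : ℕ → ℕ
  sa : ℕ → ℝ
  ea : ℕ → ℝ
  sb : ℕ → ℝ
  eb : ℕ → ℝ
  ha : ∀ i, 1 ≤ i → i ≤ N → sa i ≤ ea i
  hb : ∀ i, 1 ≤ i → i ≤ N → sb i ≤ eb i
  hab : ∀ i, 1 ≤ i → i ≤ N → ea i < sb i
  hba : ∀ i, 1 ≤ i → i < N → eb i < sa (i + 1)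

/-- Index of the last write to `R_a` completed before time `t`
(`0` if no write to `R_a` completes before `t`). -/
noncomputable def lastA {N : ℕ} (W : DWWriter N) (t : ℝ) : ℕ :=
  ((Finset.range (N + 1)).filter (fun i => 1 ≤ i ∧ W.ea i < t)).sup id

/-- Index of the last write to `R_b` completed before time `t`; since the
`i`-th AWrite completes when its write to `R_b` does, this is the index of the
last AWrite completed before time `t` (`0` if there is none). -/
noncomputable def lastB {N : ℕ} (W : DWWriter N) (t : ℝ) : ℕ :=
  ((Finset.range (N + 1)).filter (fun i => 1 ≤ i ∧ W.eb i < t)).sup id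

/-- A `k`-scan read sequence (AReadk): `2k` low-level reads over sequential
real intervals, alternating a read of `R_a` over `[ras j, rae j]` returning
`alpha j` with a read of `R_b` over `[rbs j, rbe j]` returning `beta j`,
for `j = 1, …, k`. -/
structure KScan (k : ℕ) where
  ras : ℕ → ℝ
  rae : ℕ → ℝ
  rbs : ℕ → ℝ
  rbe : ℕ → ℝ
  alpha : ℕ → ℕ
  beta : ℕ → ℕ
  hra : ∀ j, 1 ≤ j → j ≤ k → ras j ≤ rae j
  hrb : ∀ j, 1 ≤ j → j ≤ k → rbs j ≤ rbe j
  hab : ∀ j, 1 ≤ j → j ≤ k → rae j < rbs j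
  hba : ∀ j, 1 ≤ j → j < k → rbe j < ras (j + 1)

/-- Safe-register semantics: any low-level read whose interval is disjoint
from every write interval on the same register returns the value written by
the last write to that register completed before the read starts (the initial
value `x 0` if no such write exists).  Reads overlapping a write on the same
register are unconstrained (they may return an arbitrary value). -/
def SafeSem {N k : ℕ} (W : DWWriter N) (R : KScan k) : Prop :=
  (∀ j, 1 ≤ j → j ≤ k →
      (∀ i, 1 ≤ i → i ≤ N → R.rae j < W.sa i ∨ W.ea i < R.ras j) →
      R.alpha j = W.x (lastA W (R.ras j))) ∧
  (∀ j, 1 ≤ j → j ≤ k →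
      (∀ i, 1 ≤ i → i ≤ N → R.rbe j < W.sb i ∨ W.eb i < R.rbs j) →
      R.beta j = W.x (lastB W (R.rbs j)))

/-- The AReadk returns the unanimous value `v`: all `2k` low-level reads
return `v`. -/
def Returns {k : ℕ} (R : KScan k) (v : ℕ) : Prop :=
  ∀ j, 1 ≤ j → j ≤ k → R.alpha j = v ∧ R.beta j = v

/-- An AReadk is contaminated if it returns a unanimous value `v` that is not
among the written values `x 0, x 1, …, x N`. -/
def Contaminated {N k : ℕ} (W : DWWriter N) (R : KScan k) : Prop :=
  ∃ v, Returns R v ∧ ∀ i, i ≤ N → v ≠ W.x i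

theorem DWWriter.eb_lt_sa {N : ℕ} (W : DWWriter N) {i j : ℕ} (hi : 1 ≤ i) (hij : i < j)
    (hj : j ≤ N) : W.eb i < W.sa j := by
  induction j, hij using Nat.le_induction with
  | base => exact W.hba i hi (by omega)
  | succ n hn ih =>
    have h := ih (by omega)
    have h1 := W.ha n (by omega) (by omega)
    have h2 := W.hab n (by omega) (by omega)
    have h3 := W.hb n (by omega) (by omega)
    have h4 := W.hba n (by omega) (by omega)
    linarith

theorem lastA_le {N : ℕ} (W : DWWriter N) (t : ℝ) : lastA W t ≤ N :=
  Finset.sup_le fun i hi => by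
    have := Finset.mem_range.1 (Finset.mem_filter.1 hi).1
    simp only [id]
    omega

theorem lastB_le {N : ℕ} (W : DWWriter N) (t : ℝ) : lastB W t ≤ N :=
  Finset.sup_le fun i hi => by
    have := Finset.mem_range.1 (Finset.mem_filter.1 hi).1
    simp only [id]
    omega

theorem KScan.rbe_lt_ras {k : ℕ} (R : KScan k) {j l : ℕ} (hj : 1 ≤ j) (hjl : j < l)
    (hl : l ≤ k) : R.rbe j < R.ras l := by
  induction l, hjl using Nat.le_induction with
  | base => exact R.hba j hj (by omega)
  | succ n hn ih =>
    have h := ih (by omega)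
    have h1 := R.hra n (by omega) (by omega)
    have h2 := R.hab n (by omega) (by omega)
    have h3 := R.hrb n (by omega) (by omega)
    have h4 := R.hba n (by omega) (by omega)
    linarith

theorem KScan.ras_le_rbe {k : ℕ} (R : KScan k) {j : ℕ} (hj : 1 ≤ j) (hjk : j ≤ k) :
    R.ras j ≤ R.rbe j := by
  have h1 := R.hra j hj hjk
  have h2 := R.hab j hj hjk
  have h3 := R.hrb j hj hjk
  linarith

theorem KScan.ras_one_le {k : ℕ} (R : KScan k) {j : ℕ} (hj : 1 ≤ j) (hjk : j ≤ k) :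
    R.ras 1 ≤ R.ras j := by
  rcases hj.eq_or_lt with rfl | h
  · exact le_rfl
  · exact (R.ras_le_rbe le_rfl (by omega)).trans (R.rbe_lt_ras le_rfl h hjk).le

theorem KScan.rbe_le_last {k : ℕ} (R : KScan k) {j : ℕ} (hj : 1 ≤ j) (hjk : j ≤ k) :
    R.rbe j ≤ R.rbe k := by
  rcases hjk.eq_or_lt with rfl | h
  · exact le_rfl
  · exact (R.rbe_lt_ras hj h le_rfl).le.trans (R.ras_le_rbe (by omega) le_rfl)

/-- In a contaminated read, each scan meets the end of an `R_a`-write whose companion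
`R_b`-write begins before the scan is over. -/
theorem Contaminated.exists_write {N k : ℕ} {W : DWWriter N} {R : KScan k}
    (hc : Contaminated W R) (hs : SafeSem W R) {j : ℕ} (hj : 1 ≤ j) (hjk : j ≤ k) :
    ∃ i, 1 ≤ i ∧ i ≤ N ∧ R.ras j ≤ W.ea i ∧ W.sb i ≤ R.rbe j := by
  obtain ⟨v, hv, hne⟩ := hc
  obtain ⟨hα, hβ⟩ := hv j hj hjk
  have hA : ∃ i, 1 ≤ i ∧ i ≤ N ∧ W.sa i ≤ R.rae j ∧ R.ras j ≤ W.ea i := by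
    by_contra! h
    refine hne _ (lastA_le W _) (hα.symm.trans (hs.1 j hj hjk fun i hi hiN => ?_))
    exact (lt_or_ge (R.rae j) (W.sa i)).imp_right (h i hi hiN)
  have hB : ∃ i, 1 ≤ i ∧ i ≤ N ∧ W.sb i ≤ R.rbe j ∧ R.rbs j ≤ W.eb i := by
    by_contra! h
    refine hne _ (lastB_le W _) (hβ.symm.trans (hs.2 j hj hjk fun i hi hiN => ?_))
    exact (lt_or_ge (R.rbe j) (W.sb i)).imp_right (h i hi hiN)
  obtain ⟨i, hi, hiN, hai, hia⟩ := hA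
  obtain ⟨l, hl, hlN, hbl, hlb⟩ := hB
  refine ⟨i, hi, hiN, hia, ?_⟩
  rcases lt_trichotomy i l with h | rfl | h
  · have h1 := W.eb_lt_sa hi h hlN
    have h2 := W.hb i hi hiN
    have h3 := W.ha l hl hlN
    have h4 := W.hab l hl hlN
    linarith
  · exact hbl
  · have h1 := W.eb_lt_sa hl h hiN
    have h2 := R.hab j hj hjk
    linarith

/-- Contamination bound (Lemma 3): with pairwise distinct values and at most
`m·k` AWrites, among any family of sequentially performed AReadk operations at
most `m` are contaminated. -/
theorem contamination_bound {N k m : ℕ} (hk : 1 ≤ k)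
    (W : DWWriter N)
    (hdist : ∀ i j, i ≤ N → j ≤ N → W.x i = W.x j → i = j)
    (hN : N ≤ m * k)
    (T : ℕ) (R : Fin T → KScan k)
    (hsem : ∀ p, SafeSem W (R p))
    (hseq : ∀ p q : Fin T, p < q → (R p).rbe k < (R q).ras 1) :
    {p : Fin T | Contaminated W (R p)}.ncard ≤ m := by
  set C := {p : Fin T | Contaminated W (R p)}
  have hex : ∀ q : C × Fin k, ∃ i, 1 ≤ i ∧ i ≤ N ∧
      (R q.1).ras (q.2 + 1) ≤ W.ea i ∧ W.sb i ≤ (R q.1).rbe (q.2 + 1) := fun q =>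
    q.1.2.exists_write (hsem _) (by omega) (by omega)
  choose f hf1 hfN hfa hfb using hex
  have hne : ∀ q r : C × Fin k,
      (R q.1).rbe (q.2 + 1) < (R r.1).ras (r.2 + 1) → f q ≠ f r := by
    intro q r h heq
    have h1 := hfb q
    have h2 := hfa r
    rw [← heq] at h2
    have h3 := W.hab (f q) (hf1 q) (hfN q)
    linarith
  have hseq' : ∀ q r : C × Fin k, q.1 < r.1 →
      (R q.1).rbe (q.2 + 1) < (R r.1).ras (r.2 + 1) := fun q r h =>
    ((R q.1).rbe_le_last (by omega) (by omega)).trans_lt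
      ((hseq _ _ h).trans_le ((R r.1).ras_one_le (by omega) (by omega)))
  have hinj : Function.Injective f := by
    rintro ⟨p, a⟩ ⟨q, b⟩ heq
    rcases lt_trichotomy p q with h | rfl | h
    · exact absurd heq (hne _ _ (hseq' _ _ h))
    · rcases lt_trichotomy a b with h | rfl | h
      · exact absurd heq (hne _ _ ((R p).rbe_lt_ras (by omega) (by simpa using h) (by omega)))
      · rfl
      · exact absurd heq.symm
          (hne _ _ ((R p).rbe_lt_ras (by omega) (by simpa using h) (by omega)))
    · exact absurd heq.symm (hne _ _ (hseq' _ _ h))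
  have hcard : Fintype.card (C × Fin k) ≤ (Finset.Icc 1 N).card :=
    Finset.card_le_card_of_injOn f (fun q _ => by simpa using ⟨hf1 q, hfN q⟩) hinj.injOn
  rw [Fintype.card_prod, Fintype.card_fin, Nat.card_Icc, ← Nat.card_eq_fintype_card,
    Nat.card_coe_set_eq] at hcard
  exact Nat.le_of_mul_le_mul_right (by omega : C.ncard * k ≤ m * k) hk
end

section
/- Rollover of the k-bit Gray code changes exactly one bit: for every natural number k ≥ 1, gray(2^k − 1) = 2^{k−1}; hence the last codeword of the k-bit Gray code differs from the first codeword gray(0) = 0 in exactly one bit, namely bit k−1. -/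
/-- The binary reflected Gray code of `n`: `n XOR (n >>> 1)`. -/
def gray (n : ℕ) : ℕ := n ^^^ (n / 2)

theorem gray_two_pow_sub_one (k : ℕ) (hk : 1 ≤ k) : gray (2 ^ k - 1) = 2 ^ (k - 1) := by
  refine Nat.eq_of_testBit_eq fun i => ?_
  rw [gray, Nat.testBit_xor, Nat.testBit_div_two, Nat.testBit_two_pow_sub_one,
    Nat.testBit_two_pow_sub_one, Nat.testBit_two_pow, Bool.eq_iff_iff]
  simp only [bne_iff_ne, ne_eq, decide_eq_decide, decide_eq_true_eq]
  omega

/-- Rollover of the `k`-bit Gray code changes exactly one bit: for `k ≥ 1`,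
`gray (2^k − 1) = 2^(k−1)`, and hence the last codeword differs from the first
codeword `gray 0 = 0` in exactly one bit, namely bit `k − 1`. -/
theorem gray_rollover (k : ℕ) (hk : 1 ≤ k) :
    gray (2 ^ k - 1) = 2 ^ (k - 1) ∧ gray 0 = 0 ∧
      ∀ t : ℕ, Nat.testBit (gray (2 ^ k - 1)) t ≠ Nat.testBit (gray 0) t ↔
        t = k - 1 := by
  have gray_zero : gray 0 = 0 := rfl
  refine ⟨gray_two_pow_sub_one k hk, gray_zero, fun t => ?_⟩
  rw [gray_two_pow_sub_one k hk, gray_zero, Nat.testBit_two_pow]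
  simp [eq_comm]
end
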